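/- Let T be a Wang set, let V be the set of horizontal colors occurring as west or east color of a tile of T, and view each tile t as an edge from w(t) to e(t) of a directed multigraph on V. If |T| − |V| < 2 (the number of edges exceeds the number of vertices by less than 2), then T is not minimally aperiodic. -/

import Mathlib

structure WangTile (H V : Type*) where
  west : H
  east : H
  south : V
  north : V
deriving DecidableEq

def TilingOn {H V : Type*} (T : Set (WangTile H V)) (X : Set (ℤ × ℤ))
    (f : ℤ × ℤ → WangTile H V) : Prop :=
  (∀ p ∈ X, f p ∈ T) ∧
  (∀ x y : ℤ, (x, y) ∈ X → (x + 1, y) ∈ X →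
    (f (x, y)).east = (f (x + 1, y)).west) ∧
  (∀ x y : ℤ, (x, y) ∈ X → (x, y + 1) ∈ X →
    (f (x, y)).north = (f (x, y + 1)).south)

def Tiling {H V : Type*} (T : Set (WangTile H V)) (f : ℤ × ℤ → WangTile H V) : Prop :=
  TilingOn T Set.univ f

def TilesPlane {H V : Type*} (T : Set (WangTile H V)) : Prop :=
  ∃ f, Tiling T f

def PeriodicTiling {H V : Type*} (f : ℤ × ℤ → WangTile H V) : Prop :=
  ∃ u v : ℤ, (u, v) ≠ (0, 0) ∧ ∀ x y : ℤ, f (x + u, y + v) = f (x, y)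

def Aperiodic {H V : Type*} (T : Set (WangTile H V)) : Prop :=
  TilesPlane T ∧ ∀ f, Tiling T f → ¬ PeriodicTiling f

def MinimallyAperiodic {H V : Type*} (T : Set (WangTile H V)) : Prop :=
  Aperiodic T ∧ ∀ S : Set (WangTile H V), S ⊂ T → ¬ TilesPlane S

open Classical in
/-- Periodization of a one-sided sequence over a finite alphabet. -/
theorem periodization {α : Type*} [Finite α] (h : ℕ → α) (N : ℕ) :
    ∃ R : ℕ, 0 < R ∧ ∃ k : ℤ → α, (∀ z, k (z + R) = k z) ∧
      ∀ z : ℤ, ∃ i : ℕ, ∀ t : ℕ, t ≤ N → k (z + t) = h (i + t) := by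
  obtain ⟨a, b, hab, he⟩ := Finite.exists_ne_map_eq_of_infinite
    (fun i : ℕ => fun t : Fin (N + 1) => h (i + t))
  wlog hlt : a < b generalizing a b
  · exact this b a hab.symm he.symm (by omega)
  have he' : ∀ t, t ≤ N → h (a + t) = h (b + t) := fun t ht =>
    congrFun he ⟨t, by omega⟩
  obtain ⟨R, rfl⟩ : ∃ R, b = a + R := ⟨b - a, by omega⟩
  have hR : 0 < R := by omega
  have key : ∀ s, s ≤ R + N → h (a + s % R) = h (a + s) := by
    intro s
    induction s using Nat.strong_induction_on with
    | _ s ih =>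
      intro hs
      by_cases hsR : s < R
      · rw [Nat.mod_eq_of_lt hsR]
      · have h1 := ih (s - R) (by omega) (by omega)
        have h2 := he' (s - R) (by omega)
        rw [Nat.mod_eq_sub_mod (by omega), h1, h2]
        congr 1; omega
  refine ⟨R, hR, fun z => h (a + (z % R).toNat), ?_, ?_⟩
  · intro z
    simp
  · intro z
    refine ⟨a + (z % R).toNat, fun t ht => ?_⟩
    have hz0 : 0 ≤ z % (R : ℤ) := Int.emod_nonneg _ (by omega)
    have hz1 : z % (R : ℤ) < R := Int.emod_lt_of_pos _ (by omega)
    have h3 := key ((z % R).toNat + t) (by omega)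
    have h4 : ((z + t) % (R : ℤ)).toNat = ((z % R).toNat + t) % R := by
      zify
      rw [Int.toNat_of_nonneg (Int.emod_nonneg _ (by omega)), Int.toNat_of_nonneg hz0]
      simp
    simp only
    rw [h4, h3, add_assoc]

/-- A deterministic sequence over a finite alphabet is eventually periodic, with uniform period. -/
theorem det_periodic {α : Type*} [Finite α] (s : ℤ → α) (X : ℤ)
    (hd : ∀ x x', X ≤ x → X ≤ x' → s x = s x' → s (x + 1) = s (x' + 1)) :
    ∃ X', ∀ x, X' ≤ x → s (x + ((Nat.card α).factorial : ℕ)) = s x := by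
  have := Fintype.ofFinite α
  obtain ⟨a, b, hab, he⟩ := Fintype.exists_ne_map_eq_of_card_lt
    (fun i : Fin (Fintype.card α + 1) => s (X + (i : ℕ))) (by simp)
  wlog hlt : a < b generalizing a b
  · exact this b a hab.symm he.symm (lt_of_le_of_ne (not_lt.mp hlt) hab.symm)
  have hlt' : (a : ℕ) < b := hlt
  have hb := b.2
  obtain ⟨d, hdd⟩ : ∃ d : ℕ, (b : ℕ) = a + d := ⟨b - a, by omega⟩
  have h1 : ∀ n : ℕ, s (X + (a : ℕ) + n) = s (X + (a : ℕ) + n + d) := by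
    intro n
    induction n with
    | zero =>
      rw [hdd] at he
      push_cast at he ⊢
      simpa [add_assoc] using he
    | succ n ih =>
      have := hd _ _ (by omega) (by omega) ih
      push_cast
      rw [← add_assoc, this]
      congr 1; ring
  have h2 : ∀ x, X + (a : ℕ) ≤ x → s (x + d) = s x := by
    intro x hx
    have := h1 (x - (X + (a : ℕ))).toNat
    rw [Int.toNat_of_nonneg (by omega)] at this
    simpa using this.symm
  have h3 : ∀ m : ℕ, ∀ x, X + (a : ℕ) ≤ x → s (x + (m * d : ℕ)) = s x := by
    intro m
    induction m with
    | zero => intro x _; simp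
    | succ m ih =>
      intro x hx
      have h5 := ih (x + d) (by omega)
      rw [h2 x hx] at h5
      rw [← h5]
      congr 1; push_cast; ring
  obtain ⟨m, hm⟩ : d ∣ (Fintype.card α).factorial :=
    Nat.dvd_factorial (by omega) (by omega)
  refine ⟨X + (a : ℕ), fun x hx => ?_⟩
  rw [Nat.card_eq_fintype_card, hm, mul_comm]
  exact h3 m x hx

/-- `u` starts with the word `x` of length `p`, and the rest is in `W`. -/
def StartsWith {V : Type*} (p : ℕ) (x : ℕ → V) (W : Set (ℕ → V)) (u : ℕ → V) : Prop :=
  (∀ i, i < p → u i = x i) ∧ (fun i => u (p + i)) ∈ W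

def ClosedWords {V : Type*} (p q : ℕ) (x y : ℕ → V) (W : Set (ℕ → V)) : Prop :=
  ∀ w ∈ W, StartsWith p x W w ∨ StartsWith q y W w

def IsCode {V : Type*} (p q : ℕ) (x y : ℕ → V) : Prop :=
  ∃ (l : ℕ) (b c : V), b ≠ c ∧ ∀ W, ClosedWords p q x y W → ∀ u v, StartsWith p x W u →
    StartsWith q y W v → (∀ i, i < l → u i = v i) ∧ u l = b ∧ v l = c

def IsPer {V : Type*} (p q : ℕ) (x y : ℕ → V) : Prop :=
  ∃ P : ℕ, 0 < P ∧ ∀ W, ClosedWords p q x y W → ∀ w ∈ W, ∀ i, w (i + P) = w i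

theorem ClosedWords.swap {V : Type*} {p q : ℕ} {x y : ℕ → V} {W : Set (ℕ → V)}
    (h : ClosedWords p q x y W) : ClosedWords q p y x W := fun w hw => (h w hw).symm

theorem IsCode.swap {V : Type*} {p q : ℕ} {x y : ℕ → V} (h : IsCode p q x y) :
    IsCode q p y x := by
  obtain ⟨l, b, c, hbc, h⟩ := h
  refine ⟨l, c, b, hbc.symm, fun W hW u v hu hv => ?_⟩
  obtain ⟨h1, h2, h3⟩ := h W hW.swap v u hv hu
  exact ⟨fun i hi => (h1 i hi).symm, h3, h2⟩

theorem IsPer.swap {V : Type*} {p q : ℕ} {x y : ℕ → V} (h : IsPer p q x y) :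
    IsPer q p y x := by
  obtain ⟨P, hP, h⟩ := h
  exact ⟨P, hP, fun W hW => h W hW.swap⟩

/-- The defect-type dichotomy for two words. -/
theorem code_or_periodic {V : Type*} : ∀ (n p q : ℕ) (x y : ℕ → V), 0 < p → 0 < q →
    p + q ≤ n → IsCode p q x y ∨ IsPer p q x y := by
  intro n
  induction n with
  | zero => intro p q x y hp hq h; omega
  | succ n ih =>
    have key : ∀ (p q : ℕ) (x y : ℕ → V), 0 < p → 0 < q → p + q ≤ n + 1 → p ≤ q →
        IsCode p q x y ∨ IsPer p q x y := by
      intro p q x y hp hq hn hpq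
      by_cases hxy : ∃ i, i < p ∧ x i ≠ y i
      · classical
        left
        obtain ⟨hl, hne⟩ := Nat.find_spec hxy
        refine ⟨Nat.find hxy, _, _, hne, fun W hW u v hu hv => ⟨?_, ?_, ?_⟩⟩
        · intro i hi
          have := Nat.find_min hxy hi
          rw [hu.1 i (by omega), hv.1 i (by omega)]
          by_contra hc
          exact this ⟨by omega, hc⟩
        · exact hu.1 _ hl
        · exact hv.1 _ (by omega)
      · push Not at hxy
        rcases Nat.eq_or_lt_of_le hpq with rfl | hlt
        · right
          refine ⟨p, hp, fun W hW => ?_⟩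
          have hst : ∀ w ∈ W, StartsWith p x W w := by
            intro w hw
            rcases hW w hw with h | h
            · exact h
            · exact ⟨fun i hi => by rw [h.1 i hi, hxy i hi], h.2⟩
          intro w hw i
          induction i using Nat.strong_induction_on generalizing w with
          | _ i ihi =>
            have h1 := hst w hw
            by_cases hip : i < p
            · have h2 := (hst _ h1.2).1 i hip
              rw [h1.1 i hip, add_comm]
              exact h2
            · have h2 := ihi (i - p) (by omega) _ h1.2
              rw [show p + (i - p + p) = i + p by omega, show p + (i - p) = i by omega] at h2
              exact h2
        · have trans : ∀ W : Set (ℕ → V), ClosedWords p q x y W →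
              (∀ w ∈ W, StartsWith p x (W ∪ {v | ∃ w ∈ W, v = fun i => w (p + i)}) w) ∧
              ClosedWords p (q - p) x (fun i => y (p + i))
                (W ∪ {v | ∃ w ∈ W, v = fun i => w (p + i)}) := by
            intro W hW
            have h1 : ∀ w ∈ W,
                StartsWith p x (W ∪ {v | ∃ w ∈ W, v = fun i => w (p + i)}) w := by
              intro w hw
              refine ⟨fun i hi => ?_, Or.inr ⟨w, hw, rfl⟩⟩
              rcases hW w hw with h | h
              · exact h.1 i hi
              · rw [h.1 i (by omega), hxy i hi]
            refine ⟨h1, ?_⟩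
            rintro w (hw | ⟨w, hw, rfl⟩)
            · exact Or.inl (h1 w hw)
            · rcases hW w hw with h | h
              · exact Or.inl (h1 _ h.2)
              · refine Or.inr ⟨fun i hi => h.1 _ (by omega), Or.inl ?_⟩
                have h2 := h.2
                have h3 : (fun i => w (q + i)) = fun i => w (p + (q - p + i)) := by
                  funext i; congr 1; omega
                rw [h3] at h2
                exact h2
          rcases ih p (q - p) x (fun i => y (p + i)) hp (by omega) (by omega) with hc | hc
          · left
            obtain ⟨l, b, c, hbc, hc⟩ := hc
            refine ⟨p + l, b, c, hbc, fun W hW u v hu hv => ?_⟩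
            obtain ⟨t1, t2⟩ := trans W hW
            have hu1 := t1 _ hu.2
            have hv1 : StartsWith (q - p) (fun i => y (p + i))
                (W ∪ {v | ∃ w ∈ W, v = fun i => w (p + i)}) (fun i => v (p + i)) := by
              refine ⟨fun i hi => hv.1 _ (by omega), Or.inl ?_⟩
              have h2 := hv.2
              have h3 : (fun i => v (q + i)) = fun i => v (p + (q - p + i)) := by
                funext i; congr 1; omega
              rw [h3] at h2
              exact h2
            obtain ⟨r1, r2, r3⟩ := hc _ t2 _ _ hu1 hv1
            refine ⟨fun i hi => ?_, r2, r3⟩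
            by_cases hip : i < p
            · rw [hu.1 i hip, hv.1 i (by omega), hxy i hip]
            · have := r1 (i - p) (by omega)
              rwa [show p + (i - p) = i by omega] at this
          · right
            obtain ⟨P, hP, hc⟩ := hc
            exact ⟨P, hP, fun W hW w hw => hc _ (trans W hW).2 w (Or.inl hw)⟩
    intro p q x y hp hq hn
    rcases le_total p q with h | h
    · exact key p q x y hp hq hn h
    · rcases key q p y x hq hp (by omega) h with h | h
      · exact Or.inl h.swap
      · exact Or.inr h.swap

section Abstract

variable {τ H V : Type*}

/-- Abstract tilings. -/
def IsTil (w e : τ → H) (s n : τ → V) (g : ℤ → ℤ → τ) : Prop :=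
  (∀ x y, e (g x y) = w (g (x + 1) y)) ∧ (∀ x y, n (g x y) = s (g x (y + 1)))

def HasPer (w e : τ → H) (s n : τ → V) : Prop :=
  ∃ g, IsTil w e s n g ∧ ∃ R : ℕ, 0 < R ∧ ∀ x y, g (x + R) y = g x y

theorem hasPer_of_strip [Finite τ] {w e : τ → H} {s n : τ → V} {g : ℤ → ℤ → τ}
    (hg : IsTil w e s n g) (y : ℤ) (k : ℕ) (hk : 0 < k) (D X : ℤ)
    (hX : ∀ x, X ≤ x → n (g x (y + k - 1)) = s (g (x - D) y)) : HasPer w e s n := by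
  obtain ⟨R, hR, h, hper, hwin⟩ := periodization
    (fun m : ℕ => fun i : Fin k => g (X - D.natAbs + m) (y + (i : ℕ))) (2 * D.natAbs + 1)
  have hk' : (0 : ℤ) < k := by omega
  have hb : ∀ z : ℤ, (z % k).toNat < k := fun z => by
    have := Int.emod_lt_of_pos z hk'
    have := Int.emod_nonneg z hk'.ne'
    omega
  have hcol : ∀ (z : ℤ) (i : ℕ) (hi : i < k) (hi1 : i + 1 < k),
      n (h z ⟨i, hi⟩) = s (h z ⟨i + 1, hi1⟩) := by
    intro z i hi hi1
    obtain ⟨m, hm⟩ := hwin z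
    have := hm 0 (by omega)
    simp only [Nat.cast_zero, add_zero] at this
    rw [this]
    simp only
    rw [hg.2]
    push_cast
    rw [add_assoc]
  have hrow : ∀ (z : ℤ) (i : Fin k), e (h z i) = w (h (z + 1) i) := by
    intro z i
    obtain ⟨m, hm⟩ := hwin z
    have h0 := hm 0 (by omega)
    have h1 := hm 1 (by omega)
    simp only [Nat.cast_zero, add_zero, Nat.cast_one] at h0 h1
    rw [h0, h1]
    simp only
    rw [hg.1]
    push_cast
    rw [add_assoc]
  have htop : ∀ z : ℤ, n (h z ⟨k - 1, by omega⟩) = s (h (z - D) ⟨0, hk⟩) := by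
    intro z
    obtain ⟨m, hm⟩ := hwin (z - D.natAbs)
    have h0 := hm D.natAbs (by omega)
    have h1 := hm ((D.natAbs : ℤ) - D).toNat (by omega)
    have e1 : z - (D.natAbs : ℤ) + (D.natAbs : ℕ) = z := by ring
    have e2 : z - (D.natAbs : ℤ) + ((((D.natAbs : ℤ) - D).toNat : ℕ) : ℤ) = z - D := by omega
    rw [e1] at h0
    rw [e2] at h1
    rw [h0, h1]
    simp only
    have := hX (X - D.natAbs + (m + D.natAbs : ℕ)) (by omega)
    have e3 : y + ((k - 1 : ℕ) : ℤ) = y + k - 1 := by omega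
    have e4 : X - (D.natAbs : ℤ) + ((m + D.natAbs : ℕ) : ℤ) - D
      = X - D.natAbs + ((m + ((D.natAbs : ℤ) - D).toNat : ℕ) : ℤ) := by omega
    rw [e3, this, e4]
    simp
  refine ⟨fun x z => h (x - D * (z / k)) ⟨(z % k).toNat, hb z⟩, ⟨?_, ?_⟩, R, hR, ?_⟩
  · intro x z
    simp only
    rw [hrow]
    congr 2; ring
  · intro x z
    simp only
    have n0 := Int.emod_nonneg z hk'.ne'
    have n1 := Int.emod_lt_of_pos z hk'
    have ed := Int.emod_add_mul_ediv z k
    by_cases hz : z % k + 1 < k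
    · have q1 : (z + 1) / k = z / k ∧ (z + 1) % k = z % k + 1 := by
        rw [Int.ediv_emod_unique hk']
        refine ⟨by linarith, by omega, hz⟩
      have hf : (⟨((z + 1) % k).toNat, hb (z + 1)⟩ : Fin k)
          = ⟨(z % k).toNat + 1, by omega⟩ := by
        apply Fin.ext
        simp only [q1.2]
        omega
      rw [hf, q1.1]
      exact hcol _ _ _ _
    · have q1 : (z + 1) / k = z / k + 1 ∧ (z + 1) % k = 0 := by
        rw [Int.ediv_emod_unique hk']
        refine ⟨?_, by omega, by omega⟩
        have : z % (k : ℤ) = k - 1 := by omega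
        linarith
      have hf : (⟨((z + 1) % k).toNat, hb (z + 1)⟩ : Fin k) = ⟨0, hk⟩ := by
        apply Fin.ext
        simp only [q1.2]
        rfl
      have hf2 : (⟨(z % k).toNat, hb z⟩ : Fin k) = ⟨k - 1, by omega⟩ := by
        apply Fin.ext
        simp only
        omega
      rw [hf, hf2, q1.1, htop]
      congr 2; ring
  · intro x z
    simp only
    rw [← hper (x - D * (z / k))]
    congr 1; ring

theorem hasPer_of_eventually [Finite τ] {w e : τ → H} {s n : τ → V} {g : ℤ → ℤ → τ}
    (hg : IsTil w e s n g) (P : ℕ) (hP : 0 < P)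
    (h : ∀ y, ∃ X, ∀ x, X ≤ x → n (g (x + P) y) = n (g x y)) : HasPer w e s n := by
  choose X hX using h
  have hmul : ∀ y (m : ℕ) x, X y ≤ x → n (g (x + m * P) y) = n (g x y) := by
    intro y m
    induction m with
    | zero => intro x _; simp
    | succ m ih =>
      intro x hx
      have h1 := ih (x + P) (by omega)
      rw [hX y x hx] at h1
      rw [← h1]
      congr 2; push_cast; ring
  have hval : ∀ y x, X y ≤ x →
      n (g x y) = n (g ((X y).toNat * P + x % P) y) ∨ x < (X y).toNat * P := by
    intro y x hx
    by_cases hlt : x < (X y).toNat * P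
    · exact Or.inr hlt
    · left
      have n0 := Int.emod_nonneg x (show (P : ℤ) ≠ 0 by omega)
      have n1 := Int.emod_lt_of_pos x (show (0 : ℤ) < P by omega)
      have ed := Int.emod_add_mul_ediv x P
      have hle : ((X y).toNat : ℤ) ≤ x / P := by
        rw [Int.le_ediv_iff_mul_le (by omega)]
        omega
      have hge : X y ≤ (X y).toNat * P + x % P := by
        have : (X y : ℤ) ≤ (X y).toNat := Int.self_le_toNat _
        have hP1 : (1 : ℤ) ≤ P := by omega
        have : ((X y).toNat : ℤ) * 1 ≤ (X y).toNat * P :=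
          mul_le_mul_of_nonneg_left hP1 (by omega)
        omega
      rw [← hmul y (x / P - (X y).toNat).toNat _ hge]
      congr 2
      have h7 : (((x / P - (X y).toNat).toNat : ℕ) : ℤ) = x / P - (X y).toNat :=
        Int.toNat_of_nonneg (by omega)
      rw [h7]
      linarith
  obtain ⟨a, b, hab, he⟩ := Finite.exists_ne_map_eq_of_infinite
    (fun y : ℤ => fun r : Fin P => (⟨n (g ((X y).toNat * P + (r : ℕ)) y), ⟨_, rfl⟩⟩ : Set.range n))
  wlog hlt : a < b generalizing a b
  · exact this b a hab.symm he.symm (by omega)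
  refine hasPer_of_strip hg (a + 1) (b - a).toNat (by omega) 0
    (max (max (X a) (X b)) (max ((X a).toNat * P) ((X b).toNat * P))) ?_
  intro x hx
  simp only [max_le_iff] at hx
  obtain ⟨⟨h1, h2⟩, h3, h4⟩ := hx
  rw [show a + 1 + (((b - a).toNat : ℕ) : ℤ) - 1 = b by omega, sub_zero, ← hg.2]
  have v1 := (hval a x h1).resolve_right (by omega)
  have v2 := (hval b x h2).resolve_right (by omega)
  have n0 := Int.emod_nonneg x (show (P : ℤ) ≠ 0 by omega)
  have n1 := Int.emod_lt_of_pos x (show (0 : ℤ) < P by omega)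
  have h5 := congrArg Subtype.val (congrFun he ⟨(x % P).toNat, by omega⟩)
  simp only at h5
  rw [Int.toNat_of_nonneg n0] at h5
  rw [v1, v2, h5]


/-- One-sided horizontal paths. -/
def IsPath (w e : τ → H) (u : ℕ → τ) : Prop := ∀ i, e (u i) = w (u (i + 1))

/-- The only pair of different tiles with the same west color is `tA`, `tB`. -/
def Branch (w : τ → H) (tA tB : τ) : Prop :=
  tA ≠ tB ∧ w tA = w tB ∧
    ∀ t t', w t = w t' → t ≠ t' → (t = tA ∧ t' = tB) ∨ (t = tB ∧ t' = tA)

theorem Branch.symm {w : τ → H} {tA tB : τ} (h : Branch w tA tB) : Branch w tB tA :=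
  ⟨h.1.symm, h.2.1.symm, fun t t' h1 h2 => (h.2.2 t t' h1 h2).symm⟩

theorem Branch.cases {w : τ → H} {tA tB : τ} (h : Branch w tA tB) {t : τ} (ht : w t = w tA) :
    t = tA ∨ t = tB := by
  by_cases h1 : t = tA
  · exact Or.inl h1
  · rcases h.2.2 t tA ht h1 with h2 | h2
    · exact Or.inl h2.1
    · exact Or.inr h2.1

theorem Branch.det {w : τ → H} {tA tB : τ} (h : Branch w tA tB) {t t' : τ} (ht : w t = w t')
    (ha : w t ≠ w tA) : t = t' := by
  by_contra hc
  rcases h.2.2 t t' ht hc with h2 | h2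
  · exact ha (by rw [h2.1])
  · exact ha (by rw [h2.1, h.2.1])

theorem path_shift {w e : τ → H} {u : ℕ → τ} (hu : IsPath w e u) (p : ℕ) :
    IsPath w e (fun i => u (p + i)) := fun i => hu (p + i)

theorem path_of_row {w e : τ → H} {s n : τ → V} {g : ℤ → ℤ → τ}
    (hg : IsTil w e s n g) (x y : ℤ) : IsPath w e (fun i : ℕ => g (x + i) y) := by
  intro i
  have := hg.1 (x + i) y
  simp only
  rw [this]
  push_cast
  rw [add_assoc]

/-- `tA` can be followed until the branching vertex is met again. -/
def Returns (w e : τ → H) (t : τ) : Prop :=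
  ∃ u, IsPath w e u ∧ u 0 = t ∧ ∃ p, 0 < p ∧ w (u p) = w t

theorem hasPer_of_not_returns [Finite τ] {w e : τ → H} {s n : τ → V} {g : ℤ → ℤ → τ}
    (hg : IsTil w e s n g) {tA tB : τ} (hb : Branch w tA tB) (hr : ¬ Returns w e tA) :
    HasPer w e s n := by
  refine hasPer_of_eventually hg (Nat.card τ).factorial (Nat.factorial_pos _) fun y => ?_
  have hdet : ∃ X, ∀ x x', X ≤ x → X ≤ x' → g x y = g x' y → g (x + 1) y = g (x' + 1) y := by
    by_cases hx : ∃ x0, g x0 y = tA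
    · obtain ⟨x0, hx0⟩ := hx
      refine ⟨x0, fun x x' h1 h2 h => ?_⟩
      have hw : w (g (x + 1) y) = w (g (x' + 1) y) := by rw [← hg.1, ← hg.1, h]
      refine hb.det hw fun hc => hr ?_
      refine ⟨_, path_of_row hg x0 y, by simpa using hx0, (x + 1 - x0).toNat, by omega, ?_⟩
      rw [Int.toNat_of_nonneg (by omega)]
      simpa using hc
    · push Not at hx
      refine ⟨0, fun x x' h1 h2 h => ?_⟩
      have hw : w (g (x + 1) y) = w (g (x' + 1) y) := by rw [← hg.1, ← hg.1, h]
      by_contra hc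
      rcases hb.2.2 _ _ hw hc with h | h
      · exact hx _ h.1
      · exact hx _ h.2
  obtain ⟨X, hX⟩ := hdet
  obtain ⟨X', hX'⟩ := det_periodic (fun x => g x y) X hX
  exact ⟨X', fun x hx => congrArg n (hX' x hx)⟩

theorem return_word {w e : τ → H} {tA tB : τ} (hb : Branch w tA tB) (hr : Returns w e tA)
    (κ : τ → V) : ∃ (p : ℕ) (x : ℕ → V), 0 < p ∧ ∀ u, IsPath w e u → u 0 = tA →
      StartsWith p x {c | ∃ u, IsPath w e u ∧ w (u 0) = w tA ∧ c = fun i => κ (u i)}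
        (fun i => κ (u i)) := by
  classical
  obtain ⟨a, ha, ha0, hp⟩ := hr
  obtain ⟨hp0, hpw⟩ := Nat.find_spec hp
  have hmin := fun i hi => Nat.find_min hp (m := i) hi
  set p := Nat.find hp with hpdef
  refine ⟨p, fun i => κ (a i), hp0, fun u hu hu0 => ?_⟩
  have key : ∀ i, i < p → u i = a i := by
    intro i
    induction i with
    | zero => intro _; rw [hu0, ha0]
    | succ i ih =>
      intro hi
      have h1 := ih (by omega)
      have h2 : w (a (i + 1)) = w (u (i + 1)) := by rw [← ha, ← hu, h1]
      exact (hb.det h2 fun hc => hmin (i + 1) hi ⟨by omega, hc⟩).symm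
  refine ⟨fun i hi => by simp only [key i hi], _, path_shift hu p, ?_, rfl⟩
  have h1 := key (p - 1) (by omega)
  have h2 := hu (p - 1)
  have h3 := ha (p - 1)
  rw [show p - 1 + 1 = p by omega] at h2 h3
  simp only [add_zero]
  rw [← h2, h1, h3, hpw]

/-- Bounded-delay decoding at the branching vertex. -/
def Decodes (w e : τ → H) (κ : τ → V) (tA tB : τ) (l : ℕ) (α : τ → V) : Prop :=
  α tA ≠ α tB ∧ ∀ u v, IsPath w e u → IsPath w e v → u 0 = tA → v 0 = tB →
    (∀ i, i < l → κ (u i) = κ (v i)) ∧ κ (u l) = α tA ∧ κ (v l) = α tB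

theorem decodes_or_periodic {w e : τ → H} {tA tB : τ} (hb : Branch w tA tB)
    (hA : Returns w e tA) (hB : Returns w e tB) (κ : τ → V) :
    (∃ l α, Decodes w e κ tA tB l α) ∨
    ∃ P, 0 < P ∧ ∀ u, IsPath w e u → w (u 0) = w tA → ∀ i, κ (u (i + P)) = κ (u i) := by
  classical
  obtain ⟨p, x, hp, hx⟩ := return_word hb hA κ
  obtain ⟨q, y, hq, hy⟩ := return_word hb.symm hB κ
  rw [← hb.2.1] at hy
  have hcl : ClosedWords p q x y
      {c | ∃ u, IsPath w e u ∧ w (u 0) = w tA ∧ c = fun i => κ (u i)} := by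
    rintro _ ⟨u, hu, hu0, rfl⟩
    rcases hb.cases hu0 with h | h
    · exact Or.inl (hx u hu h)
    · exact Or.inr (hy u hu h)
  rcases code_or_periodic _ p q x y hp hq le_rfl with h | h
  · left
    obtain ⟨l, b, c, hbc, h⟩ := h
    refine ⟨l, fun t => if t = tA then b else c, ?_, fun u v hu hv hu0 hv0 => ?_⟩
    · simpa [hb.1.symm] using hbc
    · obtain ⟨h1, h2, h3⟩ := h _ hcl _ _ (hx u hu hu0) (hy v hv hv0)
      exact ⟨h1, by simpa using h2, by simpa [hb.1.symm] using h3⟩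
  · right
    obtain ⟨P, hP, h⟩ := h
    exact ⟨P, hP, fun u hu hu0 => h _ hcl _ ⟨u, hu, hu0, rfl⟩⟩

theorem eventually_of_periodic [Finite τ] {w e : τ → H} {s n : τ → V} {g : ℤ → ℤ → τ}
    (hg : IsTil w e s n g) {tA tB : τ} (hb : Branch w tA tB) (κ : τ → V) {P : ℕ}
    (h : ∀ u, IsPath w e u → w (u 0) = w tA → ∀ i, κ (u (i + P)) = κ (u i)) (y : ℤ) :
    ∃ X, ∀ x, X ≤ x → κ (g (x + (P * (Nat.card τ).factorial : ℕ)) y) = κ (g x y) := by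
  by_cases hx : ∃ x0, w (g x0 y) = w tA
  · obtain ⟨x0, hx0⟩ := hx
    have h1 := h _ (path_of_row hg x0 y) (by simpa using hx0)
    have h2 : ∀ m i : ℕ, κ (g (x0 + (i + P * m : ℕ)) y) = κ (g (x0 + i) y) := by
      intro m
      induction m with
      | zero => intro i; simp
      | succ m ih =>
        intro i
        rw [← ih i, ← h1 (i + P * m)]
        congr 2; push_cast; ring
    refine ⟨x0, fun x hx => ?_⟩
    have h3 := h2 (Nat.card τ).factorial (x - x0).toNat
    rw [Nat.cast_add, Int.toNat_of_nonneg (by omega)] at h3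
    rw [show x0 + (x - x0) = x by ring] at h3
    rw [← h3]
    congr 2; ring
  · push Not at hx
    obtain ⟨X, hX⟩ := det_periodic (fun x => g x y) 0 (by
      intro x x' _ _ h
      have hw : w (g (x + 1) y) = w (g (x' + 1) y) := by rw [← hg.1, ← hg.1, h]
      exact hb.det hw (hx _))
    have h2 : ∀ m : ℕ, ∀ x, X ≤ x →
        g (x + (m * (Nat.card τ).factorial : ℕ)) y = g x y := by
      intro m
      induction m with
      | zero => intro x _; simp
      | succ m ih =>
        intro x hx
        rw [← ih x hx, ← hX (x + (m * (Nat.card τ).factorial : ℕ)) (by omega)]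
        congr 1; push_cast; ring
    exact ⟨X, fun x hx => congrArg κ (h2 P x hx)⟩

/-- Bi-infinite rows. -/
def IsRow (w e : τ → H) (u : ℤ → τ) : Prop := ∀ x, e (u x) = w (u (x + 1))

def FirstDiff (u v : ℤ → τ) (a d : ℤ) : Prop :=
  a ≤ d ∧ (∀ z, a ≤ z → z < d → u z = v z) ∧ u d ≠ v d

theorem exists_firstDiff {u v : ℤ → τ} {a z : ℤ} (hz : a ≤ z) (h : u z ≠ v z) :
    ∃ d, FirstDiff u v a d := by
  classical
  have hex : ∃ m : ℕ, u (a + m) ≠ v (a + m) :=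
    ⟨(z - a).toNat, by rw [Int.toNat_of_nonneg (by omega)]; simpa using h⟩
  refine ⟨a + Nat.find hex, by omega, fun z' h1 h2 => ?_, Nat.find_spec hex⟩
  have := Nat.find_min hex (m := (z' - a).toNat) (by omega)
  rw [Int.toNat_of_nonneg (by omega)] at this
  simpa using this

theorem FirstDiff.west_eq {w e : τ → H} {u v : ℤ → τ} (hu : IsRow w e u) (hv : IsRow w e v)
    {a d : ℤ} (ha : w (u a) = w (v a)) (h : FirstDiff u v a d) : w (u d) = w (v d) := by
  rcases eq_or_lt_of_le h.1 with h1 | h1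
  · rw [← h1, ha]
  · have h2 := h.2.1 (d - 1) (by omega) (by omega)
    have h3 := hu (d - 1)
    have h4 := hv (d - 1)
    rw [sub_add_cancel] at h3 h4
    rw [← h3, ← h4, h2]

theorem FirstDiff.word {w e : τ → H} {tA tB : τ} (hb : Branch w tA tB) {κ : τ → V} {l : ℕ}
    {α : τ → V} (hκ : Decodes w e κ tA tB l α) {u v : ℤ → τ} (hu : IsRow w e u)
    (hv : IsRow w e v) {a d : ℤ} (ha : w (u a) = w (v a)) (h : FirstDiff u v a d) :
    (∀ z, a ≤ z → z < d + l → κ (u z) = κ (v z)) ∧ κ (u (d + l)) = α (u d) ∧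
      κ (v (d + l)) = α (v d) ∧ ((u d = tA ∧ v d = tB) ∨ (u d = tB ∧ v d = tA)) := by
  have hw := h.west_eq hu hv ha
  have hor := hb.2.2 _ _ hw h.2.2
  have pu : ∀ u : ℤ → τ, IsRow w e u → IsPath w e (fun i : ℕ => u (d + i)) := by
    intro u hu i
    have := hu (d + i)
    simp only
    rw [this]
    push_cast
    rw [add_assoc]
  have main : (∀ i : ℕ, i < l → κ (u (d + i)) = κ (v (d + i))) ∧ κ (u (d + l)) = α (u d) ∧
      κ (v (d + l)) = α (v d) := by
    rcases hor with ⟨h1, h2⟩ | ⟨h1, h2⟩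
    · rw [h1, h2]
      exact hκ.2 _ _ (pu u hu) (pu v hv) (by simpa using h1) (by simpa using h2)
    · rw [h1, h2]
      obtain ⟨h3, h4, h5⟩ :=
        hκ.2 _ _ (pu v hv) (pu u hu) (by simpa using h2) (by simpa using h1)
      exact ⟨fun i hi => (h3 i hi).symm, h5, h4⟩
  refine ⟨fun z h1 h2 => ?_, main.2.1, main.2.2, hor⟩
  by_cases hz : z < d
  · rw [h.2.1 z h1 hz]
  · have := main.1 (z - d).toNat (by omega)
    rw [Int.toNat_of_nonneg (by omega)] at this
    simpa using this

theorem FirstDiff.word_ne {w e : τ → H} {tA tB : τ} (hb : Branch w tA tB) {κ : τ → V} {l : ℕ}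
    {α : τ → V} (hκ : Decodes w e κ tA tB l α) {u v : ℤ → τ} (hu : IsRow w e u)
    (hv : IsRow w e v) {a d : ℤ} (ha : w (u a) = w (v a)) (h : FirstDiff u v a d) :
    κ (u (d + l)) ≠ κ (v (d + l)) := by
  obtain ⟨-, h1, h2, h3⟩ := h.word hb hκ hu hv ha
  rw [h1, h2]
  rcases h3 with ⟨h4, h5⟩ | ⟨h4, h5⟩
  · rw [h4, h5]; exact hκ.1
  · rw [h4, h5]; exact hκ.1.symm

/-- Propagation of the first difference from a row to an adjacent row. -/
theorem FirstDiff.propagate {w e : τ → H} {tA tB : τ} (hb : Branch w tA tB)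
    {κ0 κ1 : τ → V} {l0 l1 : ℕ} {α0 α1 : τ → V}
    (hκ0 : Decodes w e κ0 tA tB l0 α0) (hκ1 : Decodes w e κ1 tA tB l1 α1)
    {u0 v0 u1 v1 : ℤ → τ} (hu0 : IsRow w e u0) (hv0 : IsRow w e v0) (hu1 : IsRow w e u1)
    (hv1 : IsRow w e v1) (hu : ∀ z, κ0 (u0 z) = κ1 (u1 z)) (hv : ∀ z, κ0 (v0 z) = κ1 (v1 z))
    {a0 a1 d0 : ℤ} (ha0 : w (u0 a0) = w (v0 a0)) (ha1 : w (u1 a1) = w (v1 a1))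
    (h01 : a1 ≤ a0 + l0) (h10 : a0 ≤ a1 + l1) (h : FirstDiff u0 v0 a0 d0) :
    ∃ d1, FirstDiff u1 v1 a1 d1 ∧ d0 + l0 = d1 + l1 := by
  have hne := h.word_ne hb hκ0 hu0 hv0 ha0
  have hd0 := h.1
  have hne1 : u1 (d0 + l0) ≠ v1 (d0 + l0) := by
    intro hc
    exact hne (by rw [hu, hv, hc])
  obtain ⟨d1, hd1⟩ := exists_firstDiff (a := a1) (by omega) hne1
  have hd1' := hd1.1
  refine ⟨d1, hd1, ?_⟩
  have hne2 := hd1.word_ne hb hκ1 hu1 hv1 ha1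
  rcases lt_trichotomy (d0 + l0) (d1 + l1) with hlt | heq | hlt
  · exfalso
    apply hne
    rw [hu, hv]
    exact (hd1.word hb hκ1 hu1 hv1 ha1).1 _ (by omega) hlt
  · exact heq
  · exfalso
    apply hne2
    rw [← hu, ← hv]
    exact (h.word hb hκ0 hu0 hv0 ha0).1 _ (by omega) hlt

theorem row_of_til {w e : τ → H} {s n : τ → V} {g : ℤ → ℤ → τ}
    (hg : IsTil w e s n g) (x y : ℤ) : IsRow w e (fun z => g (x + z) y) := by
  intro z
  simp only
  rw [hg.1, add_assoc]

theorem hasPer_of_aligned [Finite τ] {w e : τ → H} {s n : τ → V} {g : ℤ → ℤ → τ}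
    (hg : IsTil w e s n g) {tA tB : τ} (hb : Branch w tA tB) {lN lS : ℕ} {α β : τ → V}
    (hN : Decodes w e n tA tB lN α) (hS : Decodes w e s tA tB lS β) (y c : ℤ)
    (h : ∀ i : ℕ, i < 4 → w (g (c + i * (lN - lS)) (y + i)) = w tA) : HasPer w e s n := by
  obtain ⟨δ, hδ⟩ : ∃ δ : ℤ, δ = lN - lS := ⟨_, rfl⟩
  have c0 := h 0 (by omega)
  have c1 := h 1 (by omega)
  have c2 := h 2 (by omega)
  have c3 := h 3 (by omega)
  rw [← hδ] at c0 c1 c2 c3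
  push_cast at c0 c1 c2 c3
  simp only [zero_mul, add_zero, one_mul] at c0 c1
  have r0 := row_of_til hg 0 y
  have r1 := row_of_til hg 0 (y + 1)
  have r2 := row_of_til hg (2 * δ) (y + 2)
  have r3 := row_of_til hg (2 * δ) (y + 3)
  have m01 : ∀ z, n (g (0 + z) y) = s (g (0 + z) (y + 1)) := fun z => hg.2 _ _
  have m23 : ∀ z, n (g (2 * δ + z) (y + 2)) = s (g (2 * δ + z) (y + 3)) := fun z => by
    rw [hg.2, add_assoc]; norm_num
  have a0 : w (g (0 + c) y) = w (g (2 * δ + c) (y + 2)) := by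
    rw [zero_add, c0, ← c2]; congr 2; ring
  have a1 : w (g (0 + (c + δ)) (y + 1)) = w (g (2 * δ + (c + δ)) (y + 3)) := by
    rw [zero_add, c1, ← c3]; congr 2; ring
  have agree : ∀ z, c ≤ z → g (0 + z) y = g (2 * δ + z) (y + 2) := by
    intro z hz
    by_contra hc
    obtain ⟨d0, hd0⟩ := exists_firstDiff (u := fun z => g (0 + z) y)
      (v := fun z => g (2 * δ + z) (y + 2)) hz hc
    obtain ⟨d1, hd1, hdd⟩ := hd0.propagate hb hN hS r0 r2 r1 r3 m01 m23 (a1 := c + δ) a0 a1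
      (by omega) (by omega)
    obtain ⟨-, p1, p2, p3⟩ := hd0.word hb hN r0 r2 a0
    obtain ⟨-, q1, q2, q3⟩ := hd1.word hb hS r1 r3 a1
    obtain ⟨-, -, p4, -⟩ := hd0.word hb hS r0 r2 a0
    obtain ⟨-, q4, -, -⟩ := hd1.word hb hN r1 r3 a1
    have e1 : α (g (0 + d0) y) = β (g (0 + d1) (y + 1)) := by
      rw [← p1, ← q1, m01, hdd]
    have e2 : α (g (0 + d1) (y + 1)) = β (g (2 * δ + d0) (y + 2)) := by
      rw [← q4, ← p4, hg.2]
      congr 2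
      · omega
      · ring
    have hα := hN.1
    have hβ := hS.1
    rcases p3 with ⟨p5, p6⟩ | ⟨p5, p6⟩ <;> rcases q3 with ⟨q5, q6⟩ | ⟨q5, q6⟩ <;>
      rw [p5, q5] at e1 <;> rw [q5, p6] at e2
    · exact hβ (e1.symm.trans e2)
    · exact hα (e1.trans e2.symm)
    · exact hα (e2.trans e1.symm)
    · exact hβ (e2.symm.trans e1)
  refine hasPer_of_strip hg y 2 (by omega) (2 * δ) (c + 2 * δ) fun x hx => ?_
  have h1 := agree (x - 2 * δ) (by omega)
  rw [zero_add, show 2 * δ + (x - 2 * δ) = x by ring] at h1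
  rw [h1, hg.2]
  congr 2; push_cast; ring

theorem hasPer_of_decodes [Finite τ] {w e : τ → H} {s n : τ → V} {g : ℤ → ℤ → τ}
    (hg : IsTil w e s n g) {tA tB : τ} (hb : Branch w tA tB) {lN lS : ℕ} {α β : τ → V}
    (hN : Decodes w e n tA tB lN α) (hS : Decodes w e s tA tB lS β) : HasPer w e s n := by
  by_cases hdet : ∀ y x x' : ℤ,
      (fun i : Fin 4 => g x (y + (i : ℕ))) = (fun i : Fin 4 => g x' (y + (i : ℕ))) →
      (fun i : Fin 4 => g (x + 1) (y + (i : ℕ))) = (fun i : Fin 4 => g (x' + 1) (y + (i : ℕ)))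
  · refine hasPer_of_eventually hg (Nat.card (Fin 4 → τ)).factorial (Nat.factorial_pos _)
      fun y => ?_
    obtain ⟨X, hX⟩ := det_periodic (fun x => fun i : Fin 4 => g x (y + (i : ℕ))) 0
      (fun x x' _ _ h => hdet y x x' h)
    refine ⟨X, fun x hx => ?_⟩
    have := congrFun (hX x hx) 0
    simp only [Fin.val_zero, Nat.cast_zero, add_zero] at this
    rw [this]
  · push Not at hdet
    obtain ⟨y, x, x', he, hne⟩ := hdet
    have he' : ∀ i : ℕ, i < 4 → g x (y + i) = g x' (y + i) := fun i hi => congrFun he ⟨i, hi⟩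
    obtain ⟨i0, hi0⟩ : ∃ i : Fin 4, g (x + 1) (y + (i : ℕ)) ≠ g (x' + 1) (y + (i : ℕ)) := by
      by_contra hc
      push Not at hc
      exact hne (funext hc)
    have hw : ∀ i : ℕ, i < 4 → w (g (x + 1) (y + i)) = w (g (x' + 1) (y + i)) := by
      intro i hi
      rw [← hg.1, ← hg.1, he' i hi]
    have up : ∀ (i : ℕ) (d : ℤ), i + 1 < 4 →
        FirstDiff (fun z => g (x + z) (y + i)) (fun z => g (x' + z) (y + i)) 1 d →
        FirstDiff (fun z => g (x + z) (y + (i + 1 : ℕ))) (fun z => g (x' + z) (y + (i + 1 : ℕ)))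
          1 (d + (lN - lS)) := by
      intro i d hi h
      obtain ⟨d1, h1, h2⟩ := h.propagate hb hN hS (row_of_til hg x _) (row_of_til hg x' _)
        (row_of_til hg x (y + (i + 1 : ℕ))) (row_of_til hg x' (y + (i + 1 : ℕ)))
        (fun z => by rw [hg.2]; push_cast; rw [add_assoc y])
        (fun z => by rw [hg.2]; push_cast; rw [add_assoc y])
        (hw i (by omega)) (a1 := 1) (hw (i + 1) hi) (by omega) (by omega)
      rwa [show d + ((lN : ℤ) - lS) = d1 by omega]
    have down : ∀ (i : ℕ) (d : ℤ), i + 1 < 4 →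
        FirstDiff (fun z => g (x + z) (y + (i + 1 : ℕ))) (fun z => g (x' + z) (y + (i + 1 : ℕ)))
          1 d →
        FirstDiff (fun z => g (x + z) (y + i)) (fun z => g (x' + z) (y + i)) 1
          (d - (lN - lS)) := by
      intro i d hi h
      obtain ⟨d1, h1, h2⟩ := h.propagate hb hS hN (row_of_til hg x _) (row_of_til hg x' _)
        (row_of_til hg x (y + i)) (row_of_til hg x' (y + i))
        (fun z => by rw [hg.2]; push_cast; rw [add_assoc y])
        (fun z => by rw [hg.2]; push_cast; rw [add_assoc y])
        (hw (i + 1) hi) (a1 := 1) (hw i (by omega)) (by omega) (by omega)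
      rwa [show d - ((lN : ℤ) - lS) = d1 by omega]
    have base : ∀ i : ℕ, i < 4 → ∀ d,
        FirstDiff (fun z => g (x + z) (y + i)) (fun z => g (x' + z) (y + i)) 1 d →
        ∃ d0, FirstDiff (fun z => g (x + z) (y + (0 : ℕ))) (fun z => g (x' + z) (y + (0 : ℕ)))
          1 d0 := by
      intro i
      induction i with
      | zero => intro _ d h; exact ⟨d, h⟩
      | succ i ih => intro hi d h; exact ih (by omega) _ (down i d hi h)
    obtain ⟨d, hd⟩ := exists_firstDiff (u := fun z => g (x + z) (y + (i0 : ℕ)))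
      (v := fun z => g (x' + z) (y + (i0 : ℕ))) (le_refl 1) hi0
    obtain ⟨d0, hd0⟩ := base i0 i0.2 d hd
    have all : ∀ i : ℕ, i < 4 → FirstDiff (fun z => g (x + z) (y + i))
        (fun z => g (x' + z) (y + i)) 1 (d0 + i * (lN - lS)) := by
      intro i
      induction i with
      | zero => intro _; simpa using hd0
      | succ i ih =>
        intro hi
        have := up i _ hi (ih (by omega))
        rwa [show d0 + (i : ℤ) * (lN - lS) + (lN - lS)
          = d0 + ((i + 1 : ℕ) : ℤ) * (lN - lS) by push_cast; ring] at this
    refine hasPer_of_aligned hg hb hN hS y (x + d0) fun i hi => ?_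
    have h4 := ((all i hi).word hb hN (row_of_til hg x _) (row_of_til hg x' _) (hw i hi)).2.2.2
    rw [add_assoc]
    rcases h4 with h5 | h5
    · exact congrArg w h5.1
    · exact (congrArg w h5.1).trans hb.2.1.symm

theorem hasPer_of_branch [Finite τ] {w e : τ → H} {s n : τ → V} {g : ℤ → ℤ → τ}
    (hg : IsTil w e s n g) {tA tB : τ} (hb : Branch w tA tB) : HasPer w e s n := by
  by_cases hA : Returns w e tA
  swap
  · exact hasPer_of_not_returns hg hb hA
  by_cases hB : Returns w e tB
  swap
  · exact hasPer_of_not_returns hg hb.symm hB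
  rcases decodes_or_periodic hb hA hB n with ⟨lN, α, hN⟩ | ⟨P, hP, h⟩
  · rcases decodes_or_periodic hb hA hB s with ⟨lS, β, hS⟩ | ⟨P, hP, h⟩
    · exact hasPer_of_decodes hg hb hN hS
    · refine hasPer_of_eventually hg (P * (Nat.card τ).factorial)
        (Nat.mul_pos hP (Nat.factorial_pos _)) fun y => ?_
      obtain ⟨X, hX⟩ := eventually_of_periodic hg hb s h (y + 1)
      refine ⟨X, fun x hx => ?_⟩
      rw [hg.2, hg.2]
      exact hX x hx
  · exact hasPer_of_eventually hg (P * (Nat.card τ).factorial)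
      (Nat.mul_pos hP (Nat.factorial_pos _)) (eventually_of_periodic hg hb n h)

theorem hasPer_of_injective [Finite τ] {w e : τ → H} {s n : τ → V} {g : ℤ → ℤ → τ}
    (hg : IsTil w e s n g) (hw : Function.Injective w) : HasPer w e s n := by
  refine hasPer_of_eventually hg (Nat.card τ).factorial (Nat.factorial_pos _) fun y => ?_
  obtain ⟨X, hX⟩ := det_periodic (fun x => g x y) 0 (fun x x' _ _ h => hw (by
    rw [← hg.1, ← hg.1, h]))
  exact ⟨X, fun x hx => congrArg n (hX x hx)⟩

end Abstract

/-- if the number of tiles (edges) of `T` exceeds the number of horizontal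
colors occurring in `T` (vertices) by less than 2, then `T` is not minimally aperiodic. -/
theorem not_minimallyAperiodic_of_few_edges {H V : Type*} [DecidableEq H]
    (T : Finset (WangTile H V))
    (hcount : T.card < (T.image WangTile.west ∪ T.image WangTile.east).card + 2) :
    ¬ MinimallyAperiodic (T : Set (WangTile H V)) := by
  rintro ⟨⟨⟨f, hf⟩, hap⟩, hmin⟩
  obtain ⟨hfT, hfH, hfV⟩ := hf
  have hT : ∀ p, f p ∈ T := fun p => hfT p trivial
  have hocc : ∀ t ∈ T, ∃ p, f p = t := by
    intro t ht
    by_contra hc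
    push Not at hc
    refine hmin (Set.range f) ⟨?_, ?_⟩ ⟨f, fun p _ => ⟨p, rfl⟩, hfH, hfV⟩
    · rintro _ ⟨p, rfl⟩
      exact hT p
    · intro hsub
      obtain ⟨p, hp⟩ := hsub ht
      exact hc p hp
  have himg : T.image WangTile.west ∪ T.image WangTile.east = T.image WangTile.west := by
    apply Finset.union_eq_left.mpr
    intro c hc
    obtain ⟨t, ht, rfl⟩ := Finset.mem_image.mp hc
    obtain ⟨⟨x, y⟩, rfl⟩ := hocc t ht
    exact Finset.mem_image.mpr ⟨_, hT (x + 1, y), (hfH x y trivial trivial).symm⟩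
  rw [himg] at hcount
  have hg : IsTil (fun t : {t // t ∈ T} => t.1.west) (fun t => t.1.east) (fun t => t.1.south)
      (fun t => t.1.north) (fun x y => ⟨f (x, y), hT (x, y)⟩) :=
    ⟨fun x y => hfH x y trivial trivial, fun x y => hfV x y trivial trivial⟩
  have hper : HasPer (fun t : {t // t ∈ T} => t.1.west) (fun t => t.1.east)
      (fun t => t.1.south) (fun t => t.1.north) := by
    by_cases hinj : Function.Injective (fun t : {t // t ∈ T} => t.1.west)
    · exact hasPer_of_injective hg hinj
    · classical
      simp only [Function.Injective] at hinj
      push Not at hinj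
      obtain ⟨tA, tB, hw, hne⟩ := hinj
      have hne' : tA.1 ≠ tB.1 := fun h => hne (Subtype.ext h)
      have key : ∀ a b : {t // t ∈ T}, a.1.west = b.1.west → a ≠ b →
          ∀ t t' : {t // t ∈ T}, t.1.west = t'.1.west → t ≠ t' → t = a ∨ t' = a := by
        intro a b hab hne t t' htt hnt
        by_contra hc
        push Not at hc
        have h1 : (T.erase a.1).image WangTile.west = T.image WangTile.west := by
          apply Finset.Subset.antisymm (Finset.image_subset_image (Finset.erase_subset _ _))
          intro c hcc
          obtain ⟨r, hr, rfl⟩ := Finset.mem_image.mp hcc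
          by_cases hra : r = a.1
          · exact Finset.mem_image.mpr ⟨b.1, Finset.mem_erase.mpr
              ⟨fun h => hne (Subtype.ext h.symm), b.2⟩, by rw [hra, hab]⟩
          · exact Finset.mem_image.mpr ⟨r, Finset.mem_erase.mpr ⟨hra, hr⟩, rfl⟩
        have h2 : ((T.erase a.1).image WangTile.west).card = (T.erase a.1).card := by
          apply le_antisymm Finset.card_image_le
          rw [h1, Finset.card_erase_of_mem a.2]
          omega
        have h3 := Finset.card_image_iff.mp h2
        exact hnt (Subtype.ext (h3
          (Finset.mem_coe.mpr (Finset.mem_erase.mpr ⟨fun h => hc.1 (Subtype.ext h), t.2⟩))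
          (Finset.mem_coe.mpr (Finset.mem_erase.mpr ⟨fun h => hc.2 (Subtype.ext h), t'.2⟩)) htt))
      refine hasPer_of_branch hg (tA := tA) (tB := tB) ⟨hne, hw, fun t t' h1 h2 => ?_⟩
      have k1 := key tA tB hw hne t t' h1 h2
      have k2 := key tB tA hw.symm hne.symm t t' h1 h2
      rcases k1 with k1 | k1 <;> rcases k2 with k2 | k2
      · exact absurd (k1.symm.trans k2) hne
      · exact Or.inl ⟨k1, k2⟩
      · exact Or.inr ⟨k2, k1⟩
      · exact absurd (k1.symm.trans k2) hne
  obtain ⟨g, hg', R, hR, hgR⟩ := hper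
  refine hap (fun p => (g p.1 p.2).1)
    ⟨fun p _ => (g p.1 p.2).2, fun x y _ _ => hg'.1 x y, fun x y _ _ => hg'.2 x y⟩
    ⟨R, 0, ?_, fun x y => ?_⟩
  · simp only [ne_eq, Prod.mk.injEq, and_true]
    omega
  · simp only [add_zero, hgR]
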